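/- Let η : T² → ℝ be twice continuously differentiable with η(x) > 0 for all x ∈ T², and let M > 0 be such that sup_{T²}|η| ≤ M, sup_{T²}|∇η| ≤ M and sup_{T²}‖∇²η‖ ≤ M. Set L = ∫_{T²} 1/η(x) dx. Then sup_{x ∈ T²} 1/η(x) ≤ (8/M)·(exp(LM/(2π)) − 1). -/

import Mathlib

open MeasureTheory Real

/-- The fundamental domain `[0,1)²` of the unit torus `T² = (ℝ/ℤ)²`, viewed inside `ℝ²`.
Functions on the torus are modelled as `1`-periodic functions on `ℝ²`, and integrals over the
torus as integrals over this fundamental domain. -/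
def torusCube : Set (EuclideanSpace ℝ (Fin 2)) :=
  {x | ∀ i, x i ∈ Set.Ico (0 : ℝ) 1}

/-- Second-order Taylor upper bound at a critical point. -/
theorem le_add_half_mul_sq_norm_of_fderiv_eq_zero {E : Type*} [NormedAddCommGroup E]
    [NormedSpace ℝ E] {f : E → ℝ} (hf : ContDiff ℝ 2 f) {M : ℝ}
    (hM : ∀ x, ‖fderiv ℝ (fderiv ℝ f) x‖ ≤ M) {x₀ : E} (h₀ : fderiv ℝ f x₀ = 0) (h : E) :
    f (x₀ + h) ≤ f x₀ + M / 2 * ‖h‖ ^ 2 := by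
  have hd : Differentiable ℝ f := hf.differentiable (by norm_num)
  have hd' : Differentiable ℝ (fderiv ℝ f) :=
    (hf.fderiv_right (m := 1) (by norm_num)).differentiable (by norm_num)
  have hlip (x : E) : ‖fderiv ℝ f x‖ ≤ M * ‖x - x₀‖ := by
    simpa [h₀] using convex_univ.norm_image_sub_le_of_norm_fderiv_le
      (fun y _ ↦ hd' y) (fun y _ ↦ hM y) (Set.mem_univ x₀) (Set.mem_univ x)
  have hφ (t : ℝ) : HasDerivAt (fun t : ℝ ↦ f (x₀ + t • h)) (fderiv ℝ f (x₀ + t • h) h) t := by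
    have hl : HasDerivAt (fun t : ℝ ↦ x₀ + t • h) h t := by
      simpa using ((hasDerivAt_id t).smul_const h).const_add x₀
    exact (hd (x₀ + t • h)).hasFDerivAt.comp_hasDerivAt t hl
  have hB (t : ℝ) : HasDerivAt (fun t : ℝ ↦ f x₀ + M / 2 * ‖h‖ ^ 2 * t ^ 2)
      (M * t * ‖h‖ ^ 2) t := by
    have := ((hasDerivAt_pow 2 t).const_mul (M / 2 * ‖h‖ ^ 2)).const_add (f x₀)
    refine this.congr_deriv ?_
    push_cast
    ring
  have key := image_le_of_deriv_right_le_deriv_boundary (a := 0) (b := 1)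
    (fun t _ ↦ (hφ t).continuousAt.continuousWithinAt)
    (fun t _ ↦ (hφ t).hasDerivWithinAt) (by simp)
    (fun t _ ↦ (hB t).continuousAt.continuousWithinAt)
    (fun t _ ↦ (hB t).hasDerivWithinAt)
    (fun t ht ↦ ?_) (Set.right_mem_Icc.2 zero_le_one)
  · simpa using key
  calc fderiv ℝ f (x₀ + t • h) h ≤ ‖fderiv ℝ f (x₀ + t • h)‖ * ‖h‖ :=
        (le_abs_self _).trans ((fderiv ℝ f (x₀ + t • h)).le_opNorm h)
    _ ≤ M * ‖x₀ + t • h - x₀‖ * ‖h‖ := by gcongr; exact hlip _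
    _ = M * t * ‖h‖ ^ 2 := by
        rw [add_sub_cancel_left, norm_smul, Real.norm_of_nonneg ht.1]
        ring

/-- Integral over a planar disc of the reciprocal of a radial quadratic. -/
theorem integral_ball_inv_add_mul_sq_norm {m M : ℝ} (hm : 0 < m) (hM : 0 < M) {R : ℝ}
    (hR : 0 ≤ R) :
    ∫ x in Metric.ball (0 : EuclideanSpace ℝ (Fin 2)) R, 1 / (m + M / 2 * ‖x‖ ^ 2) =
      2 * π / M * Real.log (1 + M * R ^ 2 / (2 * m)) := by
  have hpos (y : ℝ) : 0 < m + M / 2 * y ^ 2 := by positivity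
  have hvol : (volume : Measure (EuclideanSpace ℝ (Fin 2))).real (Metric.ball 0 1) = π := by
    simp [Measure.real, EuclideanSpace.volume_ball_fin_two, pi_nonneg]
  have hrad : ∫ y in (0 : ℝ)..R, y * (1 / (m + M / 2 * y ^ 2)) =
      1 / M * Real.log (1 + M * R ^ 2 / (2 * m)) := by
    have hderiv (y : ℝ) : HasDerivAt (fun y ↦ 1 / M * Real.log (m + M / 2 * y ^ 2))
        (y * (1 / (m + M / 2 * y ^ 2))) y := by
      have := ((((hasDerivAt_pow 2 y).const_mul (M / 2)).const_add m).log
        (hpos y).ne').const_mul (1 / M)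
      refine this.congr_deriv ?_
      have := (hpos y).ne'
      push_cast
      field_simp
    rw [intervalIntegral.integral_eq_sub_of_hasDerivAt (fun y _ ↦ hderiv y)
      (Continuous.intervalIntegrable (continuous_id.mul
        (continuous_const.div (by fun_prop) fun y ↦ (hpos y).ne')) _ _),
      ← mul_sub, ← Real.log_div (hpos R).ne' (hpos 0).ne']
    congr 2
    field_simp
    ring
  have hind (x : EuclideanSpace ℝ (Fin 2)) :
      (Metric.ball (0 : EuclideanSpace ℝ (Fin 2)) R).indicator
        (fun x ↦ 1 / (m + M / 2 * ‖x‖ ^ 2)) x =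
      (Set.Iio R).indicator (fun y ↦ 1 / (m + M / 2 * y ^ 2)) ‖x‖ := by
    by_cases hx : ‖x‖ < R <;> simp [Set.indicator, hx]
  rw [← integral_indicator measurableSet_ball, funext hind, integral_fun_norm_addHaar volume,
    hvol, finrank_euclideanSpace_fin]
  have hind' (y : ℝ) : y ^ (2 - 1) • (Set.Iio R).indicator
        (fun y ↦ 1 / (m + M / 2 * y ^ 2)) y =
      (Set.Iio R).indicator (fun y ↦ y * (1 / (m + M / 2 * y ^ 2))) y := by
    simp [Set.indicator_apply]
  simp_rw [hind']
  rw [setIntegral_indicator measurableSet_Iio, Set.Ioi_inter_Iio,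
    ← integral_Ioc_eq_integral_Ioo, ← intervalIntegral.integral_of_le hR, hrad]
  simp only [nsmul_eq_mul, smul_eq_mul]
  push_cast
  ring

local notation "stdBasis" => OrthonormalBasis.toBasis (EuclideanSpace.basisFun (Fin 2) ℝ)

theorem torusCube_eq_fundamentalDomain : torusCube = ZSpan.fundamentalDomain stdBasis := by
  ext x
  simp [torusCube]

/-- A function that is `1`-periodic in each coordinate is invariant under the standard lattice. -/
theorem apply_lattice_vadd {η : EuclideanSpace ℝ (Fin 2) → ℝ}
    (hper : ∀ x (i : Fin 2), η (x + EuclideanSpace.single i (1 : ℝ)) = η x)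
    (g : Submodule.span ℤ (Set.range stdBasis)) (x : EuclideanSpace ℝ (Fin 2)) :
    η (g +ᵥ x) = η x := by
  obtain ⟨v, hv⟩ := g
  change η (v + x) = η x
  induction hv using Submodule.span_induction generalizing x with
  | mem v hv =>
    obtain ⟨i, rfl⟩ := hv
    simpa [add_comm] using hper x i
  | zero => simp
  | add v w _ _ hv hw => rw [add_assoc, hv, hw]
  | smul n v _ hv =>
    have hv' : Function.Periodic η v := fun x ↦ by rw [add_comm, hv]
    rw [add_comm, hv'.zsmul n x]

theorem exists_forall_le_of_periodic {η : EuclideanSpace ℝ (Fin 2) → ℝ} (hη : Continuous η)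
    (hper : ∀ x (i : Fin 2), η (x + EuclideanSpace.single i (1 : ℝ)) = η x) :
    ∃ x₀, ∀ x, η x₀ ≤ η x := by
  obtain ⟨r, hr⟩ := (ZSpan.fundamentalDomain_isBounded stdBasis).subset_closedBall 0
  have hfr (x) := hr (ZSpan.fract_mem_fundamentalDomain stdBasis x)
  obtain ⟨x₀, -, hx₀⟩ := (isCompact_closedBall (0 : EuclideanSpace ℝ (Fin 2)) r).exists_isMinOn
    ⟨_, hfr 0⟩ hη.continuousOn
  refine ⟨x₀, fun x ↦ (hx₀ (hfr x)).trans_eq ?_⟩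
  have := apply_lattice_vadd hper (-ZSpan.floor stdBasis x) x
  rwa [Submodule.vadd_def, vadd_eq_add, Submodule.coe_neg, neg_add_eq_sub] at this

/-- The integral of a periodic function over the torus is at least that over any disc of
radius `1 / 2`. -/
theorem setIntegral_ball_le_setIntegral_torusCube {f : EuclideanSpace ℝ (Fin 2) → ℝ}
    (hf : Continuous f) (hf₀ : ∀ x, 0 ≤ f x)
    (hper : ∀ x (i : Fin 2), f (x + EuclideanSpace.single i (1 : ℝ)) = f x)
    (x₀ : EuclideanSpace ℝ (Fin 2)) :
    ∫ x in Metric.ball x₀ (1 / 2), f x ≤ ∫ x in torusCube, f x := by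
  have hF := ZSpan.isAddFundamentalDomain stdBasis
    (volume : Measure (EuclideanSpace ℝ (Fin 2)))
  set v : EuclideanSpace ℝ (Fin 2) := x₀ - !₂[1 / 2, 1 / 2] with hv
  have : VAddInvariantMeasure (Submodule.span ℤ (Set.range stdBasis))
      (EuclideanSpace ℝ (Fin 2)) volume :=
    inferInstanceAs (VAddInvariantMeasure
      (Submodule.span ℤ (Set.range stdBasis)).toAddSubgroup _ volume)
  have hFv := hF.vadd_of_comm v
  rw [torusCube_eq_fundamentalDomain, hF.setIntegral_eq hFv (apply_lattice_vadd hper)]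
  refine setIntegral_mono_set ?_ (.of_forall hf₀) (LE.le.eventuallyLE ?_)
  · obtain ⟨r, hr⟩ :=
      ((ZSpan.fundamentalDomain_isBounded stdBasis).vadd v).subset_closedBall 0
    exact (hf.continuousOn.integrableOn_compact (isCompact_closedBall 0 r)).mono_set hr
  · intro x hx
    rw [Set.mem_vadd_set_iff_neg_vadd_mem, ← torusCube_eq_fundamentalDomain]
    intro i
    have hi : |x i - x₀ i| < 1 / 2 :=
      (PiLp.norm_apply_le (x - x₀) i).trans_lt (mem_ball_iff_norm.1 hx)
    rw [abs_lt] at hi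
    have hvi : v i = x₀ i - 1 / 2 := by
      fin_cases i <;> simp [hv]
    have : (-v +ᵥ x) i = x i - x₀ i + 1 / 2 := by
      rw [vadd_eq_add, PiLp.add_apply, PiLp.neg_apply, hvi]
      ring
    rw [this]
    constructor <;> linarith

/-- (Lemma 2.2) Let `η : T² → ℝ` be a positive `C²` function on the unit torus and `M > 0` a
bound for `η`, its gradient, and its Hessian. With `L = ∫_{T²} 1/η`, we have
`sup 1/η ≤ (8/M)·(exp(LM/(2π)) − 1)`. -/
theorem inv_linfty_bound_of_inv_l1 (η : EuclideanSpace ℝ (Fin 2) → ℝ)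
    (hη : ContDiff ℝ 2 η)
    (hper : ∀ (x : EuclideanSpace ℝ (Fin 2)) (i : Fin 2),
      η (x + EuclideanSpace.single i (1 : ℝ)) = η x)
    (hpos : ∀ x, 0 < η x)
    (M : ℝ) (hM : 0 < M)
    (hbd : ∀ x, |η x| ≤ M)
    (hgrad : ∀ x, ‖fderiv ℝ η x‖ ≤ M)
    (hhess : ∀ x, ‖fderiv ℝ (fderiv ℝ η) x‖ ≤ M)
    (L : ℝ) (hL : L = ∫ x in torusCube, 1 / η x) :
    ∀ x, 1 / η x ≤ (8 / M) * (Real.exp (L * M / (2 * π)) - 1) := by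
  obtain ⟨x₀, hx₀⟩ := exists_forall_le_of_periodic hη.continuous hper
  have hcrit : fderiv ℝ η x₀ = 0 := IsLocalMin.fderiv_eq_zero (.of_forall hx₀)
  have hm := hpos x₀
  have hquad (y : EuclideanSpace ℝ (Fin 2)) : 0 < η x₀ + M / 2 * ‖y‖ ^ 2 := by positivity
  have hinv : Continuous fun x ↦ 1 / η x :=
    continuous_const.div hη.continuous fun x ↦ (hpos x).ne'
  have hshift : ∫ x in Metric.ball x₀ (1 / 2), 1 / η x =
      ∫ h in Metric.ball (0 : EuclideanSpace ℝ (Fin 2)) (1 / 2), 1 / η (x₀ + h) := by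
    rw [← (measurePreserving_add_left volume x₀).setIntegral_preimage_emb
      (measurableEmbedding_addLeft x₀)]
    simp
  have hlow : 2 * π / M * Real.log (1 + M * (1 / 2) ^ 2 / (2 * η x₀)) ≤ L := by
    rw [hL, ← integral_ball_inv_add_mul_sq_norm hm hM (by norm_num)]
    refine le_trans ?_ (setIntegral_ball_le_setIntegral_torusCube hinv
      (fun x ↦ (one_div_pos.2 (hpos x)).le) (fun x i ↦ by rw [hper]) x₀)
    rw [hshift]
    refine setIntegral_mono ?_ ?_ fun h ↦ one_div_le_one_div_of_le (hpos _)
      (le_add_half_mul_sq_norm_of_fderiv_eq_zero hη hhess hcrit h)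
    all_goals
      refine IntegrableOn.mono_set (ContinuousOn.integrableOn_compact
        (isCompact_closedBall 0 (1 / 2)) (Continuous.continuousOn ?_))
        Metric.ball_subset_closedBall
    · exact continuous_const.div (by fun_prop) fun y ↦ (hquad y).ne'
    · exact hinv.comp (continuous_const.add continuous_id)
  have hlog : Real.log (1 + M * (1 / 2) ^ 2 / (2 * η x₀)) ≤ L * M / (2 * π) := by
    rw [le_div_iff₀ (by positivity)]
    calc _ = 2 * π / M * Real.log (1 + M * (1 / 2) ^ 2 / (2 * η x₀)) * M := by
          field_simp
      _ ≤ L * M := by gcongr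
  have hexp := (Real.log_le_iff_le_exp (by positivity)).1 hlog
  intro x
  calc 1 / η x ≤ 1 / η x₀ := one_div_le_one_div_of_le hm (hx₀ x)
    _ = 8 / M * (M * (1 / 2) ^ 2 / (2 * η x₀)) := by field_simp; norm_num
    _ ≤ 8 / M * (Real.exp (L * M / (2 * π)) - 1) := by gcongr; linarith
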